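/- Let H = {0, 89, 178, 267, 356, 445, 534} ⊆ ℤ/623ℤ and let B = {0, 1, 4, 50, 384, 483, 571, 587} ⊆ ℤ/623ℤ. Then H is a subgroup of ℤ/623ℤ of order 7, and the eleven difference sets Δ(8ⁱ·B) for i = 0, 1, …, 10 are pairwise disjoint, each has cardinality 56, each is disjoint from H, and their union together with H \ {0} is (ℤ/623ℤ) \ {0}. -/

import Mathlib

/-- The set of differences `ΔB = {a - c : a, c ∈ B, a ≠ c}`. -/
def diffSet (B : Finset (ZMod 623)) : Finset (ZMod 623) :=
  ((B ×ˢ B).filter fun p => p.1 ≠ p.2).image fun p => p.1 - p.2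

/-- The subgroup block `H = {0, 89, 178, 267, 356, 445, 534}` of `ℤ/623ℤ`. -/
def Hblock : Finset (ZMod 623) := {0, 89, 178, 267, 356, 445, 534}

/-- The base block `B`. -/
def baseBlock : Finset (ZMod 623) := {0, 1, 4, 50, 384, 483, 571, 587}

/-- The dilates `8ⁱ · B` of the base block, for `i = 0, 1, …, 10`. -/
def dilate (i : Fin 11) : Finset (ZMod 623) :=
  baseBlock.image fun x => (8 : ZMod 623) ^ (i : ℕ) * x

theorem diffSet_eq_image_offDiag (B : Finset (ZMod 623)) :
    diffSet B = B.offDiag.image fun p => p.1 - p.2 := by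
  ext x
  simp [diffSet, and_assoc]

theorem mul_left_injective_eight_pow (i : ℕ) :
    Function.Injective fun x : ZMod 623 => 8 ^ i * x :=
  ((show IsUnit (8 : ZMod 623) from
    IsUnit.of_mul_eq_one (8 ^ 10) (by decide)).pow i).mul_right_injective

/-- The differences of `8ⁱ · B` are the `8ⁱ`-multiples of the differences of `B`. -/
theorem diffSet_dilate (i : Fin 11) :
    diffSet (dilate i) =
      baseBlock.offDiag.image fun p => (8 : ZMod 623) ^ (i : ℕ) * (p.1 - p.2) := by
  have hinj := mul_left_injective_eight_pow i
  ext x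
  simp only [diffSet_eq_image_offDiag, dilate, Finset.mem_image, Finset.mem_offDiag, Prod.exists]
  constructor
  · rintro ⟨_, _, ⟨⟨a, ha, rfl⟩, ⟨c, hc, rfl⟩, hne⟩, rfl⟩
    exact ⟨a, c, ⟨ha, hc, fun h => hne (by rw [h])⟩, by ring⟩
  · rintro ⟨a, c, ⟨ha, hc, hne⟩, rfl⟩
    exact ⟨_, _, ⟨⟨a, ha, rfl⟩, ⟨c, hc, rfl⟩, hinj.ne hne⟩, by ring⟩

theorem mem_Hblock_iff_mem_zmultiples {x : ZMod 623} :
    x ∈ Hblock ↔ x ∈ AddSubgroup.zmultiples (89 : ZMod 623) := by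
  constructor
  · have h : ∀ y ∈ Hblock, ∃ k : Fin 7, (k : ℕ) • (89 : ZMod 623) = y := by decide +kernel
    intro hx
    obtain ⟨k, rfl⟩ := h x hx
    exact AddSubgroup.nsmul_mem _ (AddSubgroup.mem_zmultiples _) _
  · have h : ∀ y ∈ Hblock, y + 89 ∈ Hblock ∧ y - 89 ∈ Hblock := by decide +kernel
    rintro ⟨k, rfl⟩
    induction k with
    | zero => decide
    | succ n ih => simpa [add_mul] using (h _ ih).1
    | pred n ih => simpa [sub_mul] using (h _ ih).2

theorem card_Hblock : Hblock.card = 7 := by decide +kernel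

theorem castHom_eq_zero_of_mem_Hblock :
    ∀ x ∈ Hblock, ZMod.castHom (show 89 ∣ 623 by norm_num) (ZMod 89) x = 0 := by
  decide +kernel

/-- The `11`-th powers of the `56` differences of `B` are distinct. -/
theorem injOn_sub_pow_eleven :
    Set.InjOn (fun p : ZMod 623 × ZMod 623 => (p.1 - p.2) ^ 11) baseBlock.offDiag := by
  rw [← Finset.card_image_iff]
  decide +kernel

/-- The elements of `B` are pairwise incongruent modulo `89`. -/
theorem injOn_castHom_baseBlock :
    Set.InjOn (ZMod.castHom (show 89 ∣ 623 by norm_num) (ZMod 89)) baseBlock := by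
  rw [← Finset.card_image_iff]
  decide +kernel

theorem castHom_sub_ne_zero {p : ZMod 623 × ZMod 623} (hp : p ∈ baseBlock.offDiag) :
    ZMod.castHom (show 89 ∣ 623 by norm_num) (ZMod 89) (p.1 - p.2) ≠ 0 := by
  rw [Finset.mem_offDiag] at hp
  rw [map_sub, sub_ne_zero]
  exact injOn_castHom_baseBlock.ne hp.1 hp.2.1 hp.2.2

theorem eight_pow_pow_eleven (i : ℕ) : ((8 : ZMod 623) ^ i) ^ 11 = 1 := by
  rw [pow_right_comm, show (8 : ZMod 623) ^ 11 = 1 by decide, one_pow]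

theorem injective_eight_pow :
    Function.Injective fun i : Fin 11 => (8 : ZMod 89) ^ (i : ℕ) := by
  decide +kernel

theorem injOn_eight_pow_mul_sub :
    Set.InjOn (fun q : Fin 11 × ZMod 623 × ZMod 623 => 8 ^ (q.1 : ℕ) * (q.2.1 - q.2.2))
      {q | q.2 ∈ baseBlock.offDiag} := by
  rintro ⟨i, p⟩ hp ⟨j, q⟩ hq h
  dsimp only at h
  have h11 := congrArg (· ^ 11) h
  simp only [mul_pow, eight_pow_pow_eleven, one_mul] at h11
  obtain rfl : p = q := injOn_sub_pow_eleven hp hq h11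
  have : Fact (Nat.Prime 89) := ⟨by norm_num⟩
  have h89 := congrArg (ZMod.castHom (show 89 ∣ 623 by norm_num) (ZMod 89)) h
  rw [map_mul, map_mul, map_pow, map_pow, map_ofNat] at h89
  rw [injective_eight_pow (mul_right_cancel₀ (castHom_sub_ne_zero hp) h89)]

theorem disjoint_diffSet_dilate {i j : Fin 11} (hij : i ≠ j) :
    Disjoint (diffSet (dilate i)) (diffSet (dilate j)) := by
  simp only [diffSet_dilate, Finset.disjoint_left, Finset.mem_image]
  rintro _ ⟨p, hp, rfl⟩ ⟨q, hq, h⟩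
  exact hij (congrArg Prod.fst
    (@injOn_eight_pow_mul_sub (j, q) hq (i, p) hp h)).symm

theorem card_diffSet_dilate (i : Fin 11) : (diffSet (dilate i)).card = 56 := by
  rw [diffSet_dilate, Finset.card_image_of_injOn]
  · decide +kernel
  · intro p hp q hq h
    exact congrArg Prod.snd (@injOn_eight_pow_mul_sub (i, p) hp (i, q) hq h)

theorem disjoint_diffSet_dilate_Hblock (i : Fin 11) :
    Disjoint (diffSet (dilate i)) Hblock := by
  simp only [diffSet_dilate, Finset.disjoint_left, Finset.mem_image]
  rintro _ ⟨p, hp, rfl⟩ hH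
  have h8 : (8 : ZMod 89) ≠ 0 := by decide
  have : Fact (Nat.Prime 89) := ⟨by norm_num⟩
  have h := castHom_eq_zero_of_mem_Hblock _ hH
  rw [map_mul, map_pow, map_ofNat] at h
  exact mul_ne_zero (pow_ne_zero _ h8) (castHom_sub_ne_zero hp) h

theorem biUnion_diffSet_dilate :
    (Finset.univ.biUnion fun i => diffSet (dilate i)) = Hblockᶜ := by
  refine Finset.eq_of_subset_of_card_le ?_ ?_
  · exact Finset.biUnion_subset.2 fun i _ =>
      Finset.subset_compl_iff_disjoint_right.2 (disjoint_diffSet_dilate_Hblock i)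
  · rw [Finset.card_biUnion fun i _ j _ hij => disjoint_diffSet_dilate hij]
    simp [card_diffSet_dilate, Finset.card_compl, card_Hblock, ZMod.card]

/-- `H` is a subgroup of `ℤ/623ℤ` of order `7`, and the eleven difference sets
`Δ(8ⁱ · B)`, `i = 0, …, 10`, are pairwise disjoint, each has cardinality `56`,
each is disjoint from `H`, and their union together with `H \ {0}` is
`ℤ/623ℤ \ {0}`. -/
theorem one_rotational_difference_family_zmod_623_14 :
    (∃ S : AddSubgroup (ZMod 623), (S : Set (ZMod 623)) = (Hblock : Set (ZMod 623))) ∧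
    Hblock.card = 7 ∧
    (∀ i j, i ≠ j → Disjoint (diffSet (dilate i)) (diffSet (dilate j))) ∧
    (∀ i, (diffSet (dilate i)).card = 56) ∧
    (∀ i, Disjoint (diffSet (dilate i)) Hblock) ∧
    (Hblock \ {0}) ∪ (Finset.univ.biUnion fun i => diffSet (dilate i)) =
      Finset.univ \ {0} := by
  refine ⟨⟨AddSubgroup.zmultiples 89, Set.ext fun x => mem_Hblock_iff_mem_zmultiples.symm⟩,
    card_Hblock, fun i j => disjoint_diffSet_dilate, card_diffSet_dilate,
    disjoint_diffSet_dilate_Hblock, ?_⟩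
  have h0 : (0 : ZMod 623) ∈ Hblock := by decide
  rw [biUnion_diffSet_dilate]
  ext x
  by_cases hx : x = 0
  · simp [hx, h0]
  · simp [hx, em]
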